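/- arXiv:2408.02339 — 2 statements merged into one kernel-verified Lean document; each statement's English description precedes it below -/
import Mathlib

section
/- If g is nonnegative and a·g(θ) < r·c for every θ ≥ t, then H is strictly decreasing on [t,∞), the improper integral a·∫_t^∞ g(u)·exp(−r(u−t)) du converges, the limit lim_{θ→∞} H(θ) exists and equals a·∫_t^∞ g(u)·exp(−r(u−t)) du, and this limit equals inf_{θ≥t} H(θ); moreover H(θ) > inf_{θ'≥t} H(θ') for every finite θ ≥ t, so the infimum is not attained (the optimal renovation date is +∞, i.e., never renovate). -/
open MeasureTheory

/-- A function that is strictly decreasing on `[t, ∞)` stays strictly above its limit. -/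
theorem StrictAntiOn.lt_of_tendsto_atTop {f : ℝ → ℝ} {t l : ℝ}
    (hf : StrictAntiOn f (Set.Ici t)) (hl : Filter.Tendsto f Filter.atTop (nhds l))
    {x : ℝ} (hx : x ∈ Set.Ici t) : l < f x := by
  have hx1 : x + 1 ∈ Set.Ici t := by simp only [Set.mem_Ici] at hx ⊢; linarith
  have hle : l ≤ f (x + 1) := by
    refine le_of_tendsto hl ?_
    filter_upwards [Filter.eventually_ge_atTop (x + 1)] with y hy
    exact hf.antitoneOn hx1 (le_trans hx1 hy) hy
  exact hle.trans_lt (hf hx hx1 (by linarith))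

/-- The limit of a function that is strictly decreasing on `[t, ∞)` is its infimum there. -/
theorem StrictAntiOn.isGLB_of_tendsto_atTop {f : ℝ → ℝ} {t l : ℝ}
    (hf : StrictAntiOn f (Set.Ici t)) (hl : Filter.Tendsto f Filter.atTop (nhds l)) :
    IsGLB (f '' Set.Ici t) l := by
  refine ⟨?_, fun b hb => ?_⟩
  · rintro _ ⟨x, hx, rfl⟩
    exact (hf.lt_of_tendsto_atTop hl hx).le
  · refine ge_of_tendsto hl ?_
    filter_upwards [Filter.eventually_ge_atTop t] with y hy
    exact hb ⟨y, hy, rfl⟩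

theorem hasDerivAt_exp_neg_mul_sub (r t θ : ℝ) :
    HasDerivAt (fun x => Real.exp (-r * (x - t))) (-r * Real.exp (-r * (θ - t))) θ := by
  have h := (((hasDerivAt_id θ).sub_const t).const_mul (-r)).exp
  simpa [mul_comm] using h

theorem integrableOn_Ici_exp_neg_mul_sub {r : ℝ} (hr : 0 < r) (t : ℝ) :
    IntegrableOn (fun u => Real.exp (-r * (u - t))) (Set.Ici t) := by
  rw [integrableOn_Ici_iff_integrableOn_Ioi]
  have h := (exp_neg_integrableOn_Ioi t hr).const_mul (Real.exp (r * t))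
  refine h.congr (Filter.Eventually.of_forall fun u => ?_)
  simp only [← Real.exp_add]
  ring_nf

theorem tendsto_exp_neg_mul_sub_atTop {r : ℝ} (hr : 0 < r) (t : ℝ) :
    Filter.Tendsto (fun u => Real.exp (-r * (u - t))) Filter.atTop (nhds 0) :=
  Real.tendsto_exp_atBot.comp <|
    (Filter.tendsto_atTop_add_const_right _ (-t) Filter.tendsto_id).const_mul_atTop_of_neg
      (neg_neg_of_pos hr)

/-- A bounded continuous function, discounted at a positive rate, is integrable on `[t, ∞)`. -/
theorem integrableOn_Ici_mul_exp_neg_mul_sub {g : ℝ → ℝ} (hg : Continuous g) {r t C : ℝ}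
    (hr : 0 < r) (hC : ∀ u ∈ Set.Ici t, ‖g u‖ ≤ C) :
    IntegrableOn (fun u => g u * Real.exp (-r * (u - t))) (Set.Ici t) :=
  (integrableOn_Ici_exp_neg_mul_sub hr t).bdd_mul hg.aestronglyMeasurable
    ((ae_restrict_iff' measurableSet_Ici).2 (Filter.Eventually.of_forall hC))

/-- If `g` is nonnegative and `a·g(θ) < r·c` for every `θ ≥ t`, then the discounted
renovation-cost functional `H` is strictly decreasing on `[t,∞)`, the improper integral
`a·∫_t^∞ g u · exp(−r(u−t)) du` converges, `H(θ)` tends, as `θ → ∞`, to this integral,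
which equals `inf_{θ≥t} H θ`; moreover `H θ > inf` for every finite `θ ≥ t`, so the
infimum is not attained (never renovate). -/
theorem never_renovate
    (t r c a : ℝ) (hr : 0 < r) (hc : 0 < c) (ha : 0 < a)
    (g : ℝ → ℝ) (hg : Continuous g)
    (H : ℝ → ℝ)
    (hH : ∀ θ : ℝ, H θ =
      c * Real.exp (-r * (θ - t)) + a * ∫ u in t..θ, g u * Real.exp (-r * (u - t)))
    (hg0 : ∀ u : ℝ, 0 ≤ g u)
    (hlt : ∀ θ ∈ Set.Ici t, a * g θ < r * c) :
    StrictAntiOn H (Set.Ici t) ∧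
    IntegrableOn (fun u : ℝ => g u * Real.exp (-r * (u - t))) (Set.Ici t) ∧
    Filter.Tendsto H Filter.atTop
      (nhds (a * ∫ u in Set.Ici t, g u * Real.exp (-r * (u - t)))) ∧
    (a * ∫ u in Set.Ici t, g u * Real.exp (-r * (u - t))) = sInf (H '' Set.Ici t) ∧
    (∀ θ ∈ Set.Ici t, sInf (H '' Set.Ici t) < H θ) := by
  have hcont : Continuous fun u : ℝ => g u * Real.exp (-r * (u - t)) := by fun_prop
  have hderiv (θ : ℝ) :
      HasDerivAt H ((a * g θ - r * c) * Real.exp (-r * (θ - t))) θ := by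
    have h := ((hasDerivAt_exp_neg_mul_sub r t θ).const_mul c).add
      ((intervalIntegral.integral_hasDerivAt_right (hcont.intervalIntegrable t θ)
        (hcont.stronglyMeasurableAtFilter _ _) hcont.continuousAt).const_mul a)
    rw [funext hH]
    exact h.congr_deriv (by ring)
  have hanti : StrictAntiOn H (Set.Ici t) := by
    refine strictAntiOn_of_deriv_neg (convex_Ici t)
      (fun θ _ => (hderiv θ).continuousAt.continuousWithinAt) fun θ hθ => ?_
    rw [(hderiv θ).deriv]
    exact mul_neg_of_neg_of_pos (sub_neg.2 (hlt θ (interior_subset hθ))) (Real.exp_pos _)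
  have hint : IntegrableOn (fun u : ℝ => g u * Real.exp (-r * (u - t))) (Set.Ici t) := by
    refine integrableOn_Ici_mul_exp_neg_mul_sub (C := r * c / a) hg hr fun u hu => ?_
    rw [Real.norm_of_nonneg (hg0 u), le_div_iff₀' ha]
    exact (hlt u hu).le
  have hlim : Filter.Tendsto H Filter.atTop
      (nhds (a * ∫ u in Set.Ici t, g u * Real.exp (-r * (u - t)))) := by
    have h := ((tendsto_exp_neg_mul_sub_atTop hr t).const_mul c).add
      ((intervalIntegral_tendsto_integral_Ioi t (hint.mono_set Set.Ioi_subset_Ici_self)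
        Filter.tendsto_id).const_mul a)
    rw [funext hH, integral_Ici_eq_integral_Ioi]
    simpa using h
  have hinf := (hanti.isGLB_of_tendsto_atTop hlim).csInf_eq (Set.nonempty_Ici.image H)
  exact ⟨hanti, hint, hlim, hinf.symm, fun θ hθ => hinf ▸ hanti.lt_of_tendsto_atTop hlim hθ⟩
end

section
/- If g is moreover nondecreasing on [t,∞) and θ⋆ ≥ t satisfies a·g(θ⋆) = r·c, then θ⋆ is a global minimizer of H on [t,∞): H(θ⋆) ≤ H(θ) for every θ ≥ t, so the optimal renovation date is θ⋆ and the building's depreciation equals c·exp(−r(θ⋆−t)) + a·∫_t^{θ⋆} g(u)·exp(−r(u−t)) du (up to the factor R). -/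
theorem hasDerivAt_discounted_cost (t r c a : ℝ) {g : ℝ → ℝ} (hg : Continuous g) (x : ℝ) :
    HasDerivAt
      (fun θ => c * Real.exp (-r * (θ - t)) + a * ∫ u in t..θ, g u * Real.exp (-r * (u - t)))
      ((a * g x - r * c) * Real.exp (-r * (x - t))) x := by
  have hcont : Continuous fun u => g u * Real.exp (-r * (u - t)) := by fun_prop
  have hexp : HasDerivAt (fun θ => Real.exp (-r * (θ - t)))
      (Real.exp (-r * (x - t)) * (-r * 1)) x :=
    (((hasDerivAt_id x).sub_const t).const_mul (-r)).exp
  have hint := intervalIntegral.integral_hasDerivAt_right (hcont.intervalIntegrable t x)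
    (hcont.stronglyMeasurableAtFilter _ _) hcont.continuousAt
  exact ((hexp.const_mul c).add (hint.const_mul a)).congr_deriv (by ring)

/-- If moreover `g` is nondecreasing on `[t,∞)` and `θ⋆ ≥ t` satisfies `a·g(θ⋆) = r·c`,
then `θ⋆` is a global minimizer of the discounted renovation-cost functional `H` on
`[t,∞)`: `H θ⋆ ≤ H θ` for every `θ ≥ t`, so the optimal renovation date is `θ⋆` and the
depreciation (up to the surface factor `R`) equals
`c·exp(−r(θ⋆−t)) + a·∫_t^{θ⋆} g u · exp(−r(u−t)) du`. -/
theorem optimal_renovation_date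
    (t r c a : ℝ) (hr : 0 < r) (hc : 0 < c) (ha : 0 < a)
    (g : ℝ → ℝ) (hg : Continuous g)
    (H : ℝ → ℝ)
    (hH : ∀ θ : ℝ, H θ =
      c * Real.exp (-r * (θ - t)) + a * ∫ u in t..θ, g u * Real.exp (-r * (u - t)))
    (hmono : MonotoneOn g (Set.Ici t))
    (θs : ℝ) (hθs : t ≤ θs) (hfoc : a * g θs = r * c) :
    (∀ θ ∈ Set.Ici t, H θs ≤ H θ) ∧
    sInf (H '' Set.Ici t) =
      c * Real.exp (-r * (θs - t)) + a * ∫ u in t..θs, g u * Real.exp (-r * (u - t)) := by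
  have hderiv (x : ℝ) :
      HasDerivAt H ((a * g x - r * c) * Real.exp (-r * (x - t))) x := by
    rw [funext hH]
    exact hasDerivAt_discounted_cost t r c a hg x
  have hcont : Continuous H := continuous_iff_continuousAt.2 fun x => (hderiv x).continuousAt
  have hanti : AntitoneOn H (Set.Icc t θs) := by
    refine antitoneOn_of_hasDerivWithinAt_nonpos (convex_Icc t θs) hcont.continuousOn
      (fun x _ => (hderiv x).hasDerivWithinAt) fun x hx => ?_
    rw [interior_Icc] at hx
    have hgx := mul_le_mul_of_nonneg_left (hmono hx.1.le hθs hx.2.le) ha.le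
    exact mul_nonpos_of_nonpos_of_nonneg (by linarith) (Real.exp_pos _).le
  have hmonoH : MonotoneOn H (Set.Ici θs) := by
    refine monotoneOn_of_hasDerivWithinAt_nonneg (convex_Ici θs) hcont.continuousOn
      (fun x _ => (hderiv x).hasDerivWithinAt) fun x hx => ?_
    rw [interior_Ici] at hx
    have hgx := mul_le_mul_of_nonneg_left (hmono hθs (hθs.trans hx.le) hx.le) ha.le
    exact mul_nonneg (by linarith) (Real.exp_pos _).le
  have hmin : ∀ θ ∈ Set.Ici t, H θs ≤ H θ := fun θ hθ => by
    rcases le_total θ θs with h | h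
    · exact hanti ⟨hθ, h⟩ ⟨hθs, le_rfl⟩ h
    · exact hmonoH Set.self_mem_Ici h h
  have hleast : IsLeast (H '' Set.Ici t) (H θs) :=
    ⟨Set.mem_image_of_mem H hθs, Set.forall_mem_image.2 hmin⟩
  exact ⟨hmin, hleast.csInf_eq.trans (hH θs)⟩
end
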